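/- Let α > 0 and β > 0, let T have the Beta(α, β) distribution, let θ = 2T − 1 with density π on [−1,1], and define P(S = s) = ∫_{−1}^{1} P_θ(S = s) π(θ) dθ where P_θ(S = s) is the FGM rank likelihood. (i) If 0 < β ≤ α, then the identity permutation e maximizes s ↦ P(S = s) over S_n. (ii) If 0 < α ≤ β, then the anti-identity a = (n, n−1, …, 1) maximizes s ↦ P(S = s) over S_n. -/

import Mathlib

open Finset

/-- The rank permutation of a vector `x ∈ ℝⁿ` with pairwise distinct coordinates:
`rankPerm x i` is (in zero-based indexing) `#{j : x j ≤ x i} - 1`.  For vectors with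
ties we set `rankPerm x = 1` (the identity permutation). -/
noncomputable def rankPerm {n : ℕ} (x : Fin n → ℝ) : Equiv.Perm (Fin n) := by
  classical
  exact if hx : Function.Injective x then
    Equiv.ofBijective
      (fun i => ⟨(Finset.univ.filter fun j => x j ≤ x i).card - 1, by
        have h1 : 0 < (Finset.univ.filter fun j => x j ≤ x i).card :=
          Finset.card_pos.mpr ⟨i, by simp⟩
        have h2 : (Finset.univ.filter fun j => x j ≤ x i).card ≤ n := by
          simpa using Finset.card_filter_le Finset.univ fun j => x j ≤ x i
        omega⟩)
      (by
        rw [← Finite.injective_iff_bijective]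
        intro i i' h
        simp only [Fin.mk.injEq] at h
        have h1 : 0 < (Finset.univ.filter fun j => x j ≤ x i).card :=
          Finset.card_pos.mpr ⟨i, by simp⟩
        have h1' : 0 < (Finset.univ.filter fun j => x j ≤ x i').card :=
          Finset.card_pos.mpr ⟨i', by simp⟩
        have hcard : (Finset.univ.filter fun j => x j ≤ x i).card
            = (Finset.univ.filter fun j => x j ≤ x i').card := by omega
        have key : ∀ a b : Fin n, x a ≤ x b →
            (Finset.univ.filter fun j => x j ≤ x a).card
              = (Finset.univ.filter fun j => x j ≤ x b).card → a = b := by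
          intro a b hab hc
          have hsub : (Finset.univ.filter fun j => x j ≤ x a)
              ⊆ (Finset.univ.filter fun j => x j ≤ x b) := by
            intro j hj
            simp only [Finset.mem_filter, Finset.mem_univ, true_and] at hj ⊢
            exact hj.trans hab
          have heq := Finset.eq_of_subset_of_card_le hsub (le_of_eq hc.symm)
          have hb : b ∈ (Finset.univ.filter fun j => x j ≤ x a) := by
            rw [heq]; simp
          simp only [Finset.mem_filter, Finset.mem_univ, true_and] at hb
          exact hx (le_antisymm hab hb)
        rcases le_total (x i) (x i') with hle | hle
        · exact key i i' hle hcard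
        · exact (key i' i hle hcard.symm).symm)
  else 1

open scoped ENNReal

/-- The Farlie--Gumbel--Morgenstern copula density with parameter `θ ∈ [−1,1]`,
`c_θ(u,v) = 1 + θ(1−2u)(1−2v)` on `[0,1]²` (and `0` outside), as a density on `ℝ²`. -/
noncomputable def fgmDensity (θ : ℝ) : ℝ × ℝ → ℝ≥0∞ :=
  (Set.Icc (0 : ℝ) 1 ×ˢ Set.Icc (0 : ℝ) 1).indicator
    fun p => ENNReal.ofReal (1 + θ * (1 - 2 * p.1) * (1 - 2 * p.2))

/-- The quantity `d_j(i₁,…,i_j)` appearing in the coefficients of the polynomial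
expansion of the FGM rank likelihood: here the tuple `(i₁,…,i_j)` (with values in
`{1,…,n}`) is given as a function `i : Fin j → ℕ`, and the summation indices
`k₁,…,k_j ∈ {1,…,n+1}` are encoded as `k : Fin j → Fin (n+1)` via `k_ℓ = k ℓ + 1`. -/
noncomputable def fgmD (n j : ℕ) (i : Fin j → ℕ) : ℝ :=
  (Nat.factorial (n + j) : ℝ)⁻¹ *
    ∑ k : Fin j → Fin (n + 1),
      (-1 : ℝ) ^ (Finset.univ.filter fun ℓ => i ℓ < (k ℓ : ℕ) + 1).card *
        ∏ p ∈ Finset.Icc 1 (n + 1),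
          (Nat.factorial (Finset.univ.filter fun ℓ => (k ℓ : ℕ) + 1 = p).card : ℝ)

open Classical in
/-- The coefficient `c_j(s)` of `θ^j` in the polynomial expansion of the FGM rank
likelihood: `c₀(s) = 1/n!` and, for `j ≥ 1`,
`c_j(s) = n! ∑_{1 ≤ i₁ < ⋯ < i_j ≤ n} d_j(i₁,…,i_j) d_j(s(i₁),…,s(i_j))`.
Increasing tuples `1 ≤ i₁ < ⋯ < i_j ≤ n` are encoded as strictly monotone functions
`i : Fin j → Fin n` via `i_ℓ = i ℓ + 1`. -/
noncomputable def fgmCoeff (n : ℕ) (s : Equiv.Perm (Fin n)) (j : ℕ) : ℝ :=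
  if j = 0 then (Nat.factorial n : ℝ)⁻¹
  else
    (Nat.factorial n : ℝ) *
      ∑ i : Fin j → Fin n,
        if StrictMono i then
          fgmD n j (fun ℓ => (i ℓ : ℕ) + 1) * fgmD n j (fun ℓ => (s (i ℓ) : ℕ) + 1)
        else 0

open MeasureTheory

/-- The FGM rank likelihood `P_θ(S = s)`: the probability that
`S = rank(V) ∘ rank(U)⁻¹ = s` when `(Uᵢ, Vᵢ)`, `i = 1,…,n`, are i.i.d. with joint
density `c_θ` on `[0,1]²`, realized on the canonical product space. -/
noncomputable def fgmRankLik (n : ℕ) (θ : ℝ) (s : Equiv.Perm (Fin n)) : ℝ :=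
  ((Measure.pi fun _ : Fin n => volume.withDensity (fgmDensity θ))
    {ω : Fin n → ℝ × ℝ |
      rankPerm (fun i => (ω i).2) * (rankPerm (fun i => (ω i).1))⁻¹ = s}).toReal

open Set in
/-- The product of the measures with densities `f i` has the product density. -/
theorem pi_withDensity_ofReal {ι E : Type*} [Fintype ι] [MeasurableSpace E] (μ : Measure E)
    [SigmaFinite μ] (f : E → ℝ) (hf : Integrable f μ) (h0 : ∀ x, 0 ≤ f x) :
    (Measure.pi fun _ : ι => μ.withDensity fun x => ENNReal.ofReal (f x))
      = (Measure.pi fun _ : ι => μ).withDensity fun x => ENNReal.ofReal (∏ i, f (x i)) := by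
  have : IsFiniteMeasure (μ.withDensity fun x => ENNReal.ofReal (f x)) :=
    isFiniteMeasure_withDensity_ofReal hf.2
  refine (Measure.pi_eq fun s hs => ?_)
  have hint : Integrable (fun x : ι → E => ∏ i, (s i).indicator f (x i))
      (Measure.pi fun _ : ι => μ) :=
    Integrable.fintype_prod fun i => hf.indicator (hs i)
  have hind : ∀ x : ι → E, (univ.pi s).indicator (fun x => ENNReal.ofReal (∏ i, f (x i))) x
      = ENNReal.ofReal (∏ i, (s i).indicator f (x i)) := by
    intro x
    by_cases hx : x ∈ univ.pi s
    · rw [indicator_of_mem hx]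
      congr 1
      exact Finset.prod_congr rfl fun i _ => (indicator_of_mem (hx i trivial) f).symm
    · rw [indicator_of_notMem hx]
      simp only [mem_univ_pi, not_forall] at hx
      obtain ⟨i, hi⟩ := hx
      rw [Finset.prod_eq_zero (Finset.mem_univ i) (indicator_of_notMem hi f), ENNReal.ofReal_zero]
  rw [withDensity_apply _ (MeasurableSet.univ_pi hs),
    ← lintegral_indicator (MeasurableSet.univ_pi hs), lintegral_congr hind,
    ← ofReal_integral_eq_lintegral_ofReal hint
      (Filter.Eventually.of_forall fun x =>
        Finset.prod_nonneg fun i _ => indicator_nonneg (fun y _ => h0 y) _),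
    integral_fintype_prod_eq_prod (fun i => (s i).indicator f),
    ENNReal.ofReal_prod_of_nonneg
      fun i _ => integral_nonneg fun x => indicator_nonneg (fun y _ => h0 y) x]
  refine Finset.prod_congr rfl fun i _ => ?_
  rw [integral_indicator (hs i), withDensity_apply _ (hs i),
    ofReal_integral_eq_lintegral_ofReal hf.integrableOn (Filter.Eventually.of_forall h0)]

section rankPerm

theorem rankPerm_apply_of_injective {n : ℕ} {x : Fin n → ℝ} (hx : Function.Injective x)
    (i : Fin n) :
    (rankPerm x i : ℕ) = (Finset.univ.filter fun j => x j ≤ x i).card - 1 := by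
  classical
  rw [rankPerm, dif_pos hx]
  simp only [Equiv.ofBijective_apply]

theorem rankPerm_of_not_injective {n : ℕ} {x : Fin n → ℝ} (hx : ¬ Function.Injective x) :
    rankPerm x = 1 := by
  rw [rankPerm, dif_neg hx]

/-- The rank permutation depends only on the relative order of the coordinates. -/
theorem rankPerm_congr {n : ℕ} {x y : Fin n → ℝ} (h : ∀ i j, x j ≤ x i ↔ y j ≤ y i) :
    rankPerm x = rankPerm y := by
  have hinj : Function.Injective x ↔ Function.Injective y := by
    simp only [Function.Injective, le_antisymm_iff, h]
  by_cases hx : Function.Injective x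
  · ext i
    rw [rankPerm_apply_of_injective hx, rankPerm_apply_of_injective (hinj.1 hx)]
    simp only [h]
  · rw [rankPerm_of_not_injective hx, rankPerm_of_not_injective (mt hinj.2 hx)]

theorem measurableSet_rankPerm_eq {n : ℕ} (σ : Equiv.Perm (Fin n)) :
    MeasurableSet {x : Fin n → ℝ | rankPerm x = σ} := by
  let pattern : (Fin n → ℝ) → Fin n → Fin n → Prop := fun x i j => x j ≤ x i
  have hpattern : Measurable pattern :=
    measurable_pi_lambda _ fun i => measurable_pi_lambda _ fun j =>
      measurableSet_setOfPred.1 (measurableSet_le (measurable_pi_apply j) (measurable_pi_apply i))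
  have heq : {x : Fin n → ℝ | rankPerm x = σ} = pattern ⁻¹' (pattern '' {x | rankPerm x = σ}) := by
    refine (Set.subset_preimage_image _ _).antisymm ?_
    rintro x ⟨y, hy, hxy⟩
    have hy' : rankPerm y = σ := hy
    rw [Set.mem_ofPred_eq, ← hy']
    exact rankPerm_congr fun i j => (iff_of_eq (congrFun (congrFun hxy i) j)).symm
  rw [heq]
  exact hpattern (Set.toFinite _).measurableSet

theorem rankPerm_one_sub {n : ℕ} {x : Fin n → ℝ} (hx : Function.Injective x) :
    rankPerm (fun i => 1 - x i) = Fin.revPerm * rankPerm x := by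
  have hx' : Function.Injective fun i => 1 - x i := fun i j h => hx (sub_right_injective h)
  ext i
  rw [Equiv.Perm.mul_apply, Fin.revPerm_apply, Fin.val_rev, rankPerm_apply_of_injective hx,
    rankPerm_apply_of_injective hx']
  simp only [sub_le_sub_iff_left]
  have hsplit := Finset.card_filter_add_card_filter_not (s := Finset.univ) fun j => x i ≤ x j
  have hinsert : (Finset.univ.filter fun j => x j ≤ x i)
      = insert i (Finset.univ.filter fun j => ¬ x i ≤ x j) := by
    ext j
    simp only [Finset.mem_filter, Finset.mem_univ, true_and, Finset.mem_insert, not_le]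
    rw [le_iff_eq_or_lt, hx.eq_iff]
  rw [hinsert, Finset.card_insert_of_notMem (by simp)]
  simp only [Finset.card_univ, Fintype.card_fin] at hsplit
  omega

theorem ae_injective_pi (n : ℕ) : ∀ᵐ x : Fin n → ℝ, Function.Injective x := by
  have hne : ∀ i j : Fin n, i ≠ j → ∀ᵐ x : Fin n → ℝ, x i ≠ x j := by
    intro i j hij
    let L : Submodule ℝ (Fin n → ℝ) :=
      LinearMap.ker (LinearMap.proj (R := ℝ) (φ := fun _ : Fin n => ℝ) i - LinearMap.proj j)
    have hL : L ≠ ⊤ := by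
      intro htop
      have hmem : Pi.single i (1 : ℝ) ∈ L := htop ▸ Submodule.mem_top
      simp [L, hij] at hmem
    refine measure_mono_null (fun x hx => ?_) (Measure.addHaar_submodule volume L hL)
    simpa [L, sub_eq_zero] using hx
  have hall : ∀ᵐ x : Fin n → ℝ, ∀ i j : Fin n, i ≠ j → x i ≠ x j := by
    simp only [ae_all_iff]
    exact hne
  filter_upwards [hall] with x hx i j hij
  by_contra h
  exact hx i j h hij

end rankPerm

/-- The product of the factors `1 - 2 uᵢ` over `i ∈ I`, supported on the unit cube. -/
noncomputable def fgmFactor {n : ℕ} (I : Finset (Fin n)) (u : Fin n → ℝ) : ℝ :=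
  ∏ i, (Set.Icc (0 : ℝ) 1).indicator (fun x => if i ∈ I then 1 - 2 * x else 1) (u i)

/-- The integral of `fgmFactor I` over the vectors with rank permutation `σ`. -/
noncomputable def fgmMoment {n : ℕ} (I : Finset (Fin n)) (σ : Equiv.Perm (Fin n)) : ℝ :=
  ∫ u in {u : Fin n → ℝ | rankPerm u = σ}, fgmFactor I u

theorem integrable_fgmFactor {n : ℕ} (I : Finset (Fin n)) : Integrable (fgmFactor I) := by
  refine Integrable.fintype_prod
    (f := fun i => (Set.Icc (0 : ℝ) 1).indicator fun x => if i ∈ I then 1 - 2 * x else 1)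
    fun i => ?_
  rw [integrable_indicator_iff measurableSet_Icc]
  refine ContinuousOn.integrableOn_Icc ?_
  split_ifs <;> fun_prop

theorem fgmFactor_one_sub {n : ℕ} (I : Finset (Fin n)) (u : Fin n → ℝ) :
    fgmFactor I (fun i => 1 - u i) = (-1) ^ I.card * fgmFactor I u := by
  have hpow : (-1 : ℝ) ^ I.card = ∏ i, if i ∈ I then (-1 : ℝ) else 1 := by
    simp [Finset.prod_ite_mem]
  rw [hpow, fgmFactor, fgmFactor, ← Finset.prod_mul_distrib]
  refine Finset.prod_congr rfl fun i _ => ?_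
  have hmem : 1 - u i ∈ Set.Icc (0 : ℝ) 1 ↔ u i ∈ Set.Icc (0 : ℝ) 1 := by
    simp only [Set.mem_Icc]
    constructor <;> rintro ⟨h, h'⟩ <;> constructor <;> linarith
  simp only [Set.indicator_apply, hmem]
  split_ifs <;> ring

theorem fgmMoment_revPerm_mul {n : ℕ} (I : Finset (Fin n)) (σ : Equiv.Perm (Fin n)) :
    fgmMoment I (Fin.revPerm * σ) = (-1) ^ I.card * fgmMoment I σ := by
  have hpres : MeasurePreserving (fun (u : Fin n → ℝ) i => 1 - u i) :=
    volume_preserving_pi fun _ => Measure.measurePreserving_sub_left volume (1 : ℝ)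
  have hemb : MeasurableEmbedding (fun (u : Fin n → ℝ) i => 1 - u i) :=
    (MeasurableEquiv.piCongrRight fun _ : Fin n =>
      MeasurableEquiv.subLeft (1 : ℝ)).measurableEmbedding
  rw [fgmMoment, fgmMoment, ← integral_indicator (measurableSet_rankPerm_eq _),
    ← integral_indicator (measurableSet_rankPerm_eq _), ← hpres.integral_comp hemb,
    ← integral_const_mul]
  refine integral_congr_ae ?_
  filter_upwards [ae_injective_pi n] with u hu
  simp only [Set.indicator_apply, Set.mem_ofPred_eq, rankPerm_one_sub hu, mul_right_inj,
    fgmFactor_one_sub, mul_ite, mul_zero]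

theorem fgmDensity_eq_ofReal (θ : ℝ) (p : ℝ × ℝ) :
    fgmDensity θ p = ENNReal.ofReal ((Set.Icc (0 : ℝ) 1 ×ˢ Set.Icc (0 : ℝ) 1).indicator
      (fun p => 1 + θ * (1 - 2 * p.1) * (1 - 2 * p.2)) p) := by
  by_cases hp : p ∈ Set.Icc (0 : ℝ) 1 ×ˢ Set.Icc (0 : ℝ) 1
  · simp only [fgmDensity, Set.indicator_of_mem hp]
  · simp only [fgmDensity, Set.indicator_of_notMem hp, ENNReal.ofReal_zero]

theorem one_add_mul_mul_nonneg {θ a b : ℝ} (hθ : |θ| ≤ 1) (ha : |a| ≤ 1) (hb : |b| ≤ 1) :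
    0 ≤ 1 + θ * a * b := by
  have h : |θ * a * b| ≤ 1 := by
    rw [abs_mul, abs_mul]
    exact mul_le_one₀ (mul_le_one₀ hθ (abs_nonneg _) ha) (abs_nonneg _) hb
  linarith [neg_abs_le (θ * a * b)]

/-- Expansion of the joint density of the sample in powers of `θ`. -/
theorem prod_fgmDensity_expand {n : ℕ} (θ : ℝ) (u v : Fin n → ℝ) :
    ∏ i, (Set.Icc (0 : ℝ) 1 ×ˢ Set.Icc (0 : ℝ) 1).indicator
        (fun p : ℝ × ℝ => 1 + θ * (1 - 2 * p.1) * (1 - 2 * p.2)) (u i, v i)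
      = ∑ I : Finset (Fin n), θ ^ I.card * (fgmFactor I u * fgmFactor I v) := by
  let k : ℝ → ℝ := (Set.Icc (0 : ℝ) 1).indicator fun _ => 1
  let g : ℝ → ℝ := (Set.Icc (0 : ℝ) 1).indicator fun x => 1 - 2 * x
  have hfac : ∀ (I : Finset (Fin n)) (x : Fin n → ℝ),
      fgmFactor I x = (∏ i ∈ I, g (x i)) * ∏ i ∈ Finset.univ \ I, k (x i) := by
    intro I x
    rw [fgmFactor, ← Finset.prod_sdiff (Finset.subset_univ I), mul_comm]
    congr 1
    · exact Finset.prod_congr rfl fun i hi => by simp [g, hi]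
    · exact Finset.prod_congr rfl fun i hi => by
        simp [k, (Finset.mem_sdiff.1 hi).2]
  have hterm : ∀ i, (Set.Icc (0 : ℝ) 1 ×ˢ Set.Icc (0 : ℝ) 1).indicator
        (fun p : ℝ × ℝ => 1 + θ * (1 - 2 * p.1) * (1 - 2 * p.2)) (u i, v i)
      = θ * (g (u i) * g (v i)) + k (u i) * k (v i) := by
    intro i
    by_cases hu : u i ∈ Set.Icc (0 : ℝ) 1 <;> by_cases hv : v i ∈ Set.Icc (0 : ℝ) 1 <;>
      simp only [Set.indicator_apply, Set.mem_prod, hu, hv, g, k, and_self, and_true, and_false,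
        if_true, if_false] <;> ring
  simp only [hterm, Finset.prod_add, Finset.powerset_univ, hfac, Finset.prod_mul_distrib,
    Finset.prod_const]
  exact Finset.sum_congr rfl fun I _ => by ring

theorem fgmRankLik_eq_sum {n : ℕ} {θ : ℝ} (hθ : |θ| ≤ 1) (s : Equiv.Perm (Fin n)) :
    fgmRankLik n θ s
      = ∑ I : Finset (Fin n), θ ^ I.card * ∑ σ, fgmMoment I σ * fgmMoment I (s * σ) := by
  classical
  set f : ℝ × ℝ → ℝ := (Set.Icc (0 : ℝ) 1 ×ˢ Set.Icc (0 : ℝ) 1).indicator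
    (fun p : ℝ × ℝ => 1 + θ * (1 - 2 * p.1) * (1 - 2 * p.2)) with hfdef
  have hf0 : ∀ p, 0 ≤ f p := by
    refine fun p => Set.indicator_nonneg (fun p hp => ?_) p
    obtain ⟨⟨h1, h2⟩, h3, h4⟩ := hp
    exact one_add_mul_mul_nonneg hθ (abs_le.2 ⟨by linarith, by linarith⟩)
      (abs_le.2 ⟨by linarith, by linarith⟩)
  have hfi : Integrable f := by
    rw [hfdef, integrable_indicator_iff (measurableSet_Icc.prod measurableSet_Icc)]
    exact ContinuousOn.integrableOn_compact (isCompact_Icc.prod isCompact_Icc) (by fun_prop)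
  let e := MeasurableEquiv.arrowProdEquivProdArrow ℝ ℝ (Fin n)
  have he := volume_measurePreserving_arrowProdEquivProdArrow ℝ ℝ (Fin n)
  let A : Set ((Fin n → ℝ) × (Fin n → ℝ)) := {p | rankPerm p.2 * (rankPerm p.1)⁻¹ = s}
  let R : Equiv.Perm (Fin n) → Set (Fin n → ℝ) := fun σ => {u | rankPerm u = σ}
  have hR : ∀ σ, MeasurableSet (R σ) := measurableSet_rankPerm_eq
  have hA : MeasurableSet A := by
    have : A = ⋃ σ, R σ ×ˢ R (s * σ) := by
      ext p
      simp [A, R, mul_inv_eq_iff_eq_mul]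
    rw [this]
    exact MeasurableSet.iUnion fun σ => (hR σ).prod (hR _)
  have hmeas : (fun _ : Fin n => (volume : Measure (ℝ × ℝ)).withDensity (fgmDensity θ))
      = fun _ => volume.withDensity fun p => ENNReal.ofReal (f p) := by
    funext _
    congr 1
    funext p
    exact fgmDensity_eq_ofReal θ p
  have hFi : Integrable fun ω : Fin n → ℝ × ℝ => ∏ i, f (ω i) :=
    Integrable.fintype_prod fun _ => hfi
  have hlik : fgmRankLik n θ s = ∫ ω in e ⁻¹' A, ∏ i, f (ω i) := by
    change ((Measure.pi fun _ : Fin n => volume.withDensity (fgmDensity θ)) (e ⁻¹' A)).toReal = _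
    rw [hmeas, pi_withDensity_ofReal volume f hfi hf0,
      withDensity_apply _ (e.measurable hA),
      integral_eq_lintegral_of_nonneg_ae
        (Filter.Eventually.of_forall fun ω => Finset.prod_nonneg fun i _ => hf0 _)
        hFi.integrableOn.aestronglyMeasurable]
    rfl
  have hind : ∀ p : (Fin n → ℝ) × (Fin n → ℝ),
      A.indicator (fun p => ∏ i, f (p.1 i, p.2 i)) p
        = ∑ I : Finset (Fin n), ∑ σ, θ ^ I.card *
          ((R σ).indicator (fgmFactor I) p.1 * (R (s * σ)).indicator (fgmFactor I) p.2) := by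
    intro p
    have hsum : ∀ I : Finset (Fin n), ∑ σ, θ ^ I.card *
        ((R σ).indicator (fgmFactor I) p.1 * (R (s * σ)).indicator (fgmFactor I) p.2)
        = if p ∈ A then θ ^ I.card * (fgmFactor I p.1 * fgmFactor I p.2) else 0 := by
      intro I
      rw [Finset.sum_eq_single (rankPerm p.1)]
      · simp only [Set.indicator_apply, R, A, Set.mem_ofPred_eq, mul_inv_eq_iff_eq_mul]
        split_ifs <;> simp
      · intro σ _ hσ
        rw [Set.indicator_of_notMem (show p.1 ∉ R σ from fun h => hσ h.symm), zero_mul, mul_zero]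
      · simp
    simp only [hsum]
    rw [Set.indicator_apply]
    split_ifs
    · exact prod_fgmDensity_expand θ p.1 p.2
    · simp
  have hint : ∀ (I : Finset (Fin n)) (σ : Equiv.Perm (Fin n)),
      Integrable fun p : (Fin n → ℝ) × (Fin n → ℝ) => θ ^ I.card *
        ((R σ).indicator (fgmFactor I) p.1 * (R (s * σ)).indicator (fgmFactor I) p.2) :=
    fun I σ => (((integrable_fgmFactor I).indicator (hR _)).mul_prod
      ((integrable_fgmFactor I).indicator (hR _))).const_mul _
  calc fgmRankLik n θ s
      = ∫ ω in e ⁻¹' A, (fun p : (Fin n → ℝ) × (Fin n → ℝ) => ∏ i, f (p.1 i, p.2 i)) (e ω) := hlik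
    _ = ∫ p in A, ∏ i, f (p.1 i, p.2 i) :=
        he.setIntegral_preimage_emb e.measurableEmbedding (fun p => ∏ i, f (p.1 i, p.2 i)) A
    _ = ∫ p : (Fin n → ℝ) × (Fin n → ℝ), ∑ I : Finset (Fin n), ∑ σ, θ ^ I.card *
          ((R σ).indicator (fgmFactor I) p.1 * (R (s * σ)).indicator (fgmFactor I) p.2) := by
        rw [← integral_indicator hA]
        exact integral_congr_ae (Filter.Eventually.of_forall hind)
    _ = ∑ I : Finset (Fin n), θ ^ I.card * ∑ σ, fgmMoment I σ * fgmMoment I (s * σ) := by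
        rw [integral_finsetSum _ fun I _ => integrable_finsetSum _ fun σ _ => hint I σ]
        refine Finset.sum_congr rfl fun I _ => ?_
        rw [integral_finsetSum _ fun σ _ => hint I σ, Finset.mul_sum]
        refine Finset.sum_congr rfl fun σ _ => ?_
        rw [integral_const_mul, Measure.volume_eq_prod, integral_prod_mul,
          integral_indicator (hR _), integral_indicator (hR _)]
        rfl

theorem sum_mul_mul_left_le_sum_sq {G : Type*} [Group G] [Fintype G] (D : G → ℝ) (s : G) :
    ∑ σ, D σ * D (s * σ) ≤ ∑ σ, D σ * D σ := by
  have hshift : ∑ σ, D (s * σ) * D (s * σ) = ∑ σ, D σ * D σ :=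
    Equiv.sum_comp (Equiv.mulLeft s) fun σ => D σ * D σ
  have hle : ∑ σ, 2 * (D σ * D (s * σ)) ≤ ∑ σ, (D σ * D σ + D (s * σ) * D (s * σ)) :=
    Finset.sum_le_sum fun σ _ => by nlinarith [sq_nonneg (D σ - D (s * σ))]
  rw [Finset.sum_add_distrib, hshift, ← Finset.mul_sum] at hle
  linarith

theorem abs_sum_mul_mul_left_le_sum_sq {G : Type*} [Group G] [Fintype G] (D : G → ℝ) (s : G) :
    |∑ σ, D σ * D (s * σ)| ≤ ∑ σ, D σ * D σ :=
  calc |∑ σ, D σ * D (s * σ)| ≤ ∑ σ, |D σ| * |D (s * σ)| := by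
        simpa only [abs_mul] using
          Finset.abs_sum_le_sum_abs (fun σ => D σ * D (s * σ)) Finset.univ
    _ ≤ ∑ σ, |D σ| * |D σ| := sum_mul_mul_left_le_sum_sq (fun σ => |D σ|) s
    _ = ∑ σ, D σ * D σ := by simp only [abs_mul_abs_self]

section Beta

theorem integrableOn_rpow_mul_one_sub_rpow {α β : ℝ} (hα : 0 < α) (hβ : 0 < β) :
    IntegrableOn (fun t : ℝ => t ^ (α - 1) * (1 - t) ^ (β - 1)) (Set.Ioo 0 1) := by
  have hconv := Complex.betaIntegral_convergent (u := α) (v := β) (by simpa) (by simpa)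
  rw [intervalIntegrable_iff_integrableOn_Ioo_of_le zero_le_one] at hconv
  refine (integrableOn_congr_fun (fun t ht => ?_) measurableSet_Ioo).1 hconv.re
  obtain ⟨h0, h1⟩ := ht
  have h1' : (0 : ℝ) ≤ 1 - t := by linarith
  have hc : (t : ℂ) ^ ((α : ℂ) - 1) * (1 - (t : ℂ)) ^ ((β : ℂ) - 1)
      = ((t ^ (α - 1) * (1 - t) ^ (β - 1) : ℝ) : ℂ) := by
    push_cast [Complex.ofReal_cpow h0.le, Complex.ofReal_cpow h1']
    rfl
  simp only [hc]
  exact Complex.ofReal_re _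

/-- The `k`-th moment of `2t - 1` against the unnormalised Beta weight. -/
noncomputable def betaMoment (α β : ℝ) (k : ℕ) : ℝ :=
  ∫ t in Set.Ioo (0 : ℝ) 1, (2 * t - 1) ^ k * (t ^ (α - 1) * (1 - t) ^ (β - 1))

theorem integrableOn_pow_mul_beta {α β : ℝ} (hα : 0 < α) (hβ : 0 < β) (k : ℕ) :
    IntegrableOn (fun t : ℝ => (2 * t - 1) ^ k * (t ^ (α - 1) * (1 - t) ^ (β - 1)))
      (Set.Ioo 0 1) := by
  refine Integrable.bdd_mul (c := 1) (integrableOn_rpow_mul_one_sub_rpow hα hβ)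
    (by fun_prop) ?_
  refine (ae_restrict_iff' measurableSet_Ioo).2 (Filter.Eventually.of_forall fun t ht => ?_)
  rw [norm_pow, Real.norm_eq_abs]
  exact pow_le_one₀ (abs_nonneg _) (abs_le.2 ⟨by linarith [ht.1], by linarith [ht.2]⟩)

theorem betaMoment_swap (α β : ℝ) (k : ℕ) :
    betaMoment β α k = (-1) ^ k * betaMoment α β k := by
  have hpre : (fun t : ℝ => 1 - t) ⁻¹' Set.Ioo 0 1 = Set.Ioo 0 1 := by simp
  have h := (Measure.measurePreserving_sub_left volume (1 : ℝ)).setIntegral_preimage_emb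
    (MeasurableEquiv.subLeft (1 : ℝ)).measurableEmbedding
    (fun t => (2 * t - 1) ^ k * (t ^ (β - 1) * (1 - t) ^ (α - 1))) (Set.Ioo 0 1)
  rw [hpre] at h
  rw [betaMoment, ← h, betaMoment, ← integral_const_mul]
  congr 1
  funext t
  rw [show 2 * (1 - t) - 1 = -1 * (2 * t - 1) by ring, mul_pow, sub_sub_cancel]
  ring

theorem rpow_mul_one_sub_rpow_le {α β t : ℝ} (hβα : β ≤ α) (h0 : 0 < t) (h1 : t ≤ 1 / 2) :
    t ^ (α - 1) * (1 - t) ^ (β - 1) ≤ t ^ (β - 1) * (1 - t) ^ (α - 1) := by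
  have h1' : 0 < 1 - t := by linarith
  have hpow : t ^ (α - β) ≤ (1 - t) ^ (α - β) :=
    Real.rpow_le_rpow h0.le (by linarith) (by linarith)
  rw [show α - 1 = (α - β) + (β - 1) by ring, Real.rpow_add h0, Real.rpow_add h1']
  have hnn : 0 ≤ t ^ (β - 1) * (1 - t) ^ (β - 1) := by positivity
  nlinarith [mul_le_mul_of_nonneg_right hpow hnn]

theorem betaMoment_nonneg {α β : ℝ} (hα : 0 < α) (hβ : 0 < β) (hβα : β ≤ α) (k : ℕ) :
    0 ≤ betaMoment α β k := by
  rcases Nat.even_or_odd k with hk | hk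
  · refine setIntegral_nonneg measurableSet_Ioo fun t ht => ?_
    have h1 : 0 < 1 - t := by linarith [ht.2]
    have h0 := ht.1
    exact mul_nonneg (hk.pow_nonneg _) (by positivity)
  · have hswap := betaMoment_swap α β k
    rw [hk.neg_one_pow] at hswap
    have hdiff : 0 ≤ betaMoment α β k - betaMoment β α k := by
      rw [betaMoment, betaMoment, ← integral_sub (integrableOn_pow_mul_beta hα hβ k)
        (integrableOn_pow_mul_beta hβ hα k)]
      refine setIntegral_nonneg measurableSet_Ioo fun t ht => ?_
      rw [← mul_sub]
      rcases le_total t (1 / 2) with h | h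
      · exact mul_nonneg_of_nonpos_of_nonpos (hk.pow_nonpos (by linarith))
          (sub_nonpos.2 (rpow_mul_one_sub_rpow_le hβα ht.1 h))
      · refine mul_nonneg (pow_nonneg (by linarith) _) (sub_nonneg.2 ?_)
        have := rpow_mul_one_sub_rpow_le (t := 1 - t) hβα (by linarith [ht.2]) (by linarith)
        rw [sub_sub_cancel] at this
        linarith
    linarith

theorem betaMoment_neg_one_pow_nonneg {α β : ℝ} (hα : 0 < α) (hβ : 0 < β) (hαβ : α ≤ β)
    (k : ℕ) : 0 ≤ (-1) ^ k * betaMoment α β k :=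
  betaMoment_swap α β k ▸ betaMoment_nonneg hβ hα hαβ k

end Beta

/-- The marginal rank likelihood under a Beta prior as a combination of prior moments. -/
theorem integral_fgmRankLik_mul_beta {n : ℕ} {α β : ℝ} (hα : 0 < α) (hβ : 0 < β) (Z : ℝ)
    (s : Equiv.Perm (Fin n)) :
    (∫ t in Set.Ioo (0 : ℝ) 1, fgmRankLik n (2 * t - 1) s *
        (t ^ (α - 1) * (1 - t) ^ (β - 1) / Z))
      = (∑ I : Finset (Fin n), betaMoment α β I.card *
          ∑ σ, fgmMoment I σ * fgmMoment I (s * σ)) / Z := by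
  have hexp : ∀ t ∈ Set.Ioo (0 : ℝ) 1, fgmRankLik n (2 * t - 1) s *
        (t ^ (α - 1) * (1 - t) ^ (β - 1) / Z)
      = ∑ I : Finset (Fin n), (2 * t - 1) ^ I.card * (t ^ (α - 1) * (1 - t) ^ (β - 1)) *
          ((∑ σ, fgmMoment I σ * fgmMoment I (s * σ)) / Z) := by
    intro t ht
    rw [fgmRankLik_eq_sum (abs_le.2 ⟨by linarith [ht.1], by linarith [ht.2]⟩), Finset.sum_mul]
    exact Finset.sum_congr rfl fun I _ => by ring
  rw [setIntegral_congr_fun measurableSet_Ioo hexp, integral_finsetSum _ fun I _ =>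
    (integrableOn_pow_mul_beta hα hβ I.card).mul_const _, Finset.sum_div]
  refine Finset.sum_congr rfl fun I _ => ?_
  rw [integral_mul_const, betaMoment, mul_div_assoc]

/-- Let `α, β > 0`, let `T ∼ Beta(α, β)` and `θ = 2T − 1`, and define the marginal
distribution `P(S = s) = ∫ P_θ(S = s) π(θ) dθ = ∫_0^1 P_{2t−1}(S = s) f_{α,β}(t) dt`,
where `f_{α,β}` is the `Beta(α,β)` density.  (i) If `0 < β ≤ α`, the identity
permutation maximizes `s ↦ P(S = s)`; (ii) if `0 < α ≤ β`, the anti-identity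
maximizes it. -/
theorem fgm_marginal_mode_beta_prior (n : ℕ) (α β : ℝ) (hα : 0 < α) (hβ : 0 < β) :
    (β ≤ α →
      ∀ s : Equiv.Perm (Fin n),
        (∫ t in Set.Ioo (0 : ℝ) 1, fgmRankLik n (2 * t - 1) s *
            (t ^ (α - 1) * (1 - t) ^ (β - 1)
              / ∫ u in Set.Ioo (0 : ℝ) 1, u ^ (α - 1) * (1 - u) ^ (β - 1)))
          ≤ ∫ t in Set.Ioo (0 : ℝ) 1, fgmRankLik n (2 * t - 1) 1 *
              (t ^ (α - 1) * (1 - t) ^ (β - 1)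
                / ∫ u in Set.Ioo (0 : ℝ) 1, u ^ (α - 1) * (1 - u) ^ (β - 1)))
    ∧ (α ≤ β →
      ∀ s : Equiv.Perm (Fin n),
        (∫ t in Set.Ioo (0 : ℝ) 1, fgmRankLik n (2 * t - 1) s *
            (t ^ (α - 1) * (1 - t) ^ (β - 1)
              / ∫ u in Set.Ioo (0 : ℝ) 1, u ^ (α - 1) * (1 - u) ^ (β - 1)))
          ≤ ∫ t in Set.Ioo (0 : ℝ) 1,
              fgmRankLik n (2 * t - 1) (Fin.revPerm : Equiv.Perm (Fin n)) *
                (t ^ (α - 1) * (1 - t) ^ (β - 1)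
                  / ∫ u in Set.Ioo (0 : ℝ) 1, u ^ (α - 1) * (1 - u) ^ (β - 1))) := by
  have hZ : 0 ≤ ∫ u in Set.Ioo (0 : ℝ) 1, u ^ (α - 1) * (1 - u) ^ (β - 1) :=
    setIntegral_nonneg measurableSet_Ioo fun t ht =>
      mul_nonneg (Real.rpow_nonneg ht.1.le _) (Real.rpow_nonneg (by linarith [ht.2]) _)
  refine ⟨fun h s => ?_, fun h s => ?_⟩
  · rw [integral_fgmRankLik_mul_beta hα hβ, integral_fgmRankLik_mul_beta hα hβ]
    refine div_le_div_of_nonneg_right (Finset.sum_le_sum fun I _ => ?_) hZ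
    simp only [one_mul]
    exact mul_le_mul_of_nonneg_left (sum_mul_mul_left_le_sum_sq (fgmMoment I) s)
      (betaMoment_nonneg hα hβ h _)
  · rw [integral_fgmRankLik_mul_beta hα hβ, integral_fgmRankLik_mul_beta hα hβ]
    refine div_le_div_of_nonneg_right (Finset.sum_le_sum fun I _ => ?_) hZ
    have hm := betaMoment_neg_one_pow_nonneg hα hβ h I.card
    have hrev : ∑ σ, fgmMoment I σ * fgmMoment I (Fin.revPerm * σ)
        = (-1) ^ I.card * ∑ σ, fgmMoment I σ * fgmMoment I σ := by
      rw [Finset.mul_sum]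
      exact Finset.sum_congr rfl fun σ _ => by rw [fgmMoment_revPerm_mul]; ring
    calc betaMoment α β I.card * ∑ σ, fgmMoment I σ * fgmMoment I (s * σ)
        ≤ |betaMoment α β I.card| * |∑ σ, fgmMoment I σ * fgmMoment I (s * σ)| := by
          rw [← abs_mul]
          exact le_abs_self _
      _ ≤ |betaMoment α β I.card| * ∑ σ, fgmMoment I σ * fgmMoment I σ :=
          mul_le_mul_of_nonneg_left (abs_sum_mul_mul_left_le_sum_sq _ s) (abs_nonneg _)
      _ = betaMoment α β I.card * ∑ σ, fgmMoment I σ * fgmMoment I (Fin.revPerm * σ) := by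
          rw [hrev, ← mul_assoc, mul_comm (betaMoment α β I.card), ← abs_of_nonneg hm, abs_mul,
            abs_neg_one_pow, one_mul]
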